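/- arXiv:1907.11419 — 6 statements merged into one kernel-verified Lean document; each statement's English description precedes it below -/
import Mathlib

section
/- Every maximal π-inductive algebra equals B, the algebra of multiplication operators. In particular, the (q−1)-dimensional irreducible representation π of the affine group of a finite field has a unique maximal inductive algebra, and it is self-adjoint. -/
open scoped BigOperators

namespace AffineInductive

variable {k : Type*} [Field k]

/-- The operator `π(a,b)` on functions `kˣ → ℂ`:
`(π(a,b)F)(a') = χ(a'·b) · F(a'·a)`. -/
noncomputable def piRep (χ : AddChar k ℂ) (a : kˣ) (b : k) :
    (kˣ → ℂ) ≃ₗ[ℂ] (kˣ → ℂ) where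
  toFun F := fun a' => χ ((a' : k) * b) * F (a' * a)
  map_add' F G := by funext a'; simp [mul_add]
  map_smul' c F := by funext a'; simp [smul_eq_mul]; ring
  invFun G := fun x => χ (-(((x * a⁻¹ : kˣ) : k) * b)) * G (x * a⁻¹)
  left_inv F := by
    funext x
    have h : χ (-(((x * a⁻¹ : kˣ) : k) * b)) * χ (((x * a⁻¹ : kˣ) : k) * b) = 1 := by
      rw [← AddChar.map_add_eq_mul]; simp
    simp only []
    rw [← mul_assoc, h, one_mul, inv_mul_cancel_right]
  right_inv G := by
    funext a'
    have h : χ (((a' : k)) * b) * χ (-(((a' * a * a⁻¹ : kˣ) : k) * b)) = 1 := by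
      rw [← AddChar.map_add_eq_mul]; simp
    simp only []
    rw [← mul_assoc, h, one_mul, mul_inv_cancel_right]

/-- The multiplication operator `m_φ`. -/
def mulOp (φ : kˣ → ℂ) : Module.End ℂ (kˣ → ℂ) where
  toFun F := fun a' => φ a' * F a'
  map_add' F G := by funext a'; simp [mul_add]
  map_smul' c F := by funext a'; simp [smul_eq_mul]; ring

/-- A `π`-inductive algebra: a commutative subalgebra of `End(H)` stable under
conjugation by every `π(a,b)`. -/
def IsInductive (χ : AddChar k ℂ) (A : Subalgebra ℂ (Module.End ℂ (kˣ → ℂ))) : Prop :=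
  (∀ T ∈ A, ∀ S ∈ A, T * S = S * T) ∧
  ∀ T ∈ A, ∀ (a : kˣ) (b : k),
    (piRep χ a b).toLinearMap * T * (piRep χ a b).symm.toLinearMap ∈ A

/-- The weight space `A_b = {T ∈ A | π(1,b') T π(1,b')⁻¹ = χ(b·b') T for all b'}`. -/
noncomputable def weightSpace (χ : AddChar k ℂ)
    (A : Subalgebra ℂ (Module.End ℂ (kˣ → ℂ))) (b : k) :
    Submodule ℂ (Module.End ℂ (kˣ → ℂ)) where
  carrier := {T | T ∈ A ∧ ∀ b' : k,
    (piRep χ 1 b').toLinearMap * T * (piRep χ 1 b').symm.toLinearMap = χ (b * b') • T}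
  add_mem' := by
    rintro T S ⟨hTA, hT⟩ ⟨hSA, hS⟩
    refine ⟨add_mem hTA hSA, fun b' => ?_⟩
    rw [mul_add, add_mul, hT b', hS b', smul_add]
  zero_mem' := ⟨zero_mem A, fun b' => by simp⟩
  smul_mem' := by
    rintro c T ⟨hTA, hT⟩
    refine ⟨A.smul_mem hTA c, fun b' => ?_⟩
    rw [mul_smul_comm, smul_mul_assoc, hT b', smul_comm]

/-- The inner product on `H`. -/
noncomputable def inn [Fintype k] [DecidableEq k] (F G : kˣ → ℂ) : ℂ :=
  ∑ a' : kˣ, F a' * (starRingEnd ℂ) (G a')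

/-- The multiplicative stabilizer of the support of `t`. -/
def supportStabilizer (t : k → ℂ) : Set k := {m | m ≠ 0 ∧ ∀ v, t (m * v) = 0 ↔ t v = 0}

/-- A nonzero solution of the functional equation has `1 - u⁻¹` in the stabilizer of its
support for each `u` in that support. -/
lemma one_sub_inv_mem_supportStabilizer [Finite k] {t : k → ℂ} (h0 : t 0 = 0) (h1 : t 1 = 0)
    (h : ∀ u v : k, u ≠ 0 → v ≠ 0 → t u * t (v - v / u) = t v * t (u - u / v))
    {u : k} (hu : t u ≠ 0) : 1 - u⁻¹ ∈ supportStabilizer t := by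
  have hu0 : u ≠ 0 := fun e => hu (e ▸ h0)
  have hm : 1 - u⁻¹ ≠ 0 := by
    intro e
    have : u = 1 := by rw [sub_eq_zero, eq_comm, inv_eq_one] at e; exact e
    exact hu (this ▸ h1)
  have hmaps : Set.MapsTo (fun v => (1 - u⁻¹) * v) {v | t v = 0} {v | t v = 0} := by
    intro v hv
    change t v = 0 at hv
    change t ((1 - u⁻¹) * v) = 0
    by_cases hv0 : v = 0
    · simpa [hv0] using h0
    have e := h u v hu0 hv0
    rw [hv, zero_mul, mul_eq_zero] at e
    have e' : (1 - u⁻¹) * v = v - v / u := by field_simp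
    rw [e']
    exact e.resolve_left hu
  have hinj : Function.Injective (fun v => (1 - u⁻¹) * v) := mul_right_injective₀ hm
  have hsurj : Set.SurjOn (fun v => (1 - u⁻¹) * v) {v | t v = 0} {v | t v = 0} :=
    ((Set.toFinite _).injOn_iff_bijOn_of_mapsTo hmaps).1 hinj.injOn |>.surjOn
  refine ⟨hm, fun v => ⟨fun hv => ?_, fun hv => hmaps hv⟩⟩
  obtain ⟨w, hw, hwv⟩ := hsurj hv
  rwa [← hinj hwv]

/-- The functional equation expressing that a weight operator commutes with its
conjugates has only the zero solution. -/
lemma eq_zero_of_functional_equation [Finite k] {t : k → ℂ} (h0 : t 0 = 0) (h1 : t 1 = 0)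
    (h : ∀ u v : k, u ≠ 0 → v ≠ 0 → t u * t (v - v / u) = t v * t (u - u / v)) (u : k) :
    t u = 0 := by
  by_contra hu
  have hu0 : u ≠ 0 := fun e => hu (e ▸ h0)
  set M := supportStabilizer t
  set D : Set k := {d | ∀ z, z / u ∈ M → (z - d) / u ∈ M}
  have hmul : ∀ {m n : k}, m ∈ M → n ∈ M → m * n ∈ M := fun {m n} hm hn =>
    ⟨mul_ne_zero hm.1 hn.1, fun v => by rw [mul_assoc, hm.2, hn.2]⟩
  have hone : (1 : k) ∈ M := ⟨one_ne_zero, fun v => by rw [one_mul]⟩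
  have hMD : M ⊆ D := by
    intro w hw z hz
    have hz0 : z ≠ 0 := fun e => hz.1 (by simp [e])
    have htz : t (z / w) ≠ 0 := by
      rw [Ne, ← hw.2, mul_div_cancel₀ _ hw.1, ← div_mul_cancel₀ z hu0, hz.2]
      exact hu
    have e : (z - w) / u = z / u * (1 - (z / w)⁻¹) := by
      have := hw.1
      field_simp
    rw [e]
    exact hmul hz (one_sub_inv_mem_supportStabilizer h0 h1 h htz)
  have h0D : (0 : k) ∈ D := fun z hz => by rwa [sub_zero]
  have hss : M ⊂ D := (Set.ssubset_iff_of_subset hMD).2 ⟨0, h0D, fun h => h.1 rfl⟩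
  have hlt : M.ncard < D.ncard := Set.ncard_lt_ncard hss (Set.toFinite _)
  refine hlt.not_ge (Set.ncard_le_ncard_of_injOn (fun d => (u - d) / u) ?_ ?_ (Set.toFinite _))
  · intro d hd
    exact hd u (by rwa [div_self hu0])
  · intro d _ d' _ e
    simpa [div_left_inj' hu0] using e

section Entries

variable [DecidableEq k]

/-- The `(x, y)` matrix entry of an operator on functions `kˣ → ℂ`. -/
def entry (T : Module.End ℂ (kˣ → ℂ)) (x y : kˣ) : ℂ := T (Pi.single y 1) x

lemma entry_conj (χ : AddChar k ℂ) (T : Module.End ℂ (kˣ → ℂ)) (a : kˣ) (b : k) (x y : kˣ) :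
    entry ((piRep χ a b).toLinearMap * T * (piRep χ a b).symm.toLinearMap) x y =
      χ (((x : k) - y) * b) * entry T (x * a) (y * a) := by
  have hsymm : (piRep χ a b).symm (Pi.single y 1) =
      χ (-((y : k) * b)) • (Pi.single (y * a) 1 : kˣ → ℂ) := by
    funext z
    change χ (-(((z * a⁻¹ : kˣ) : k) * b)) * (Pi.single y 1 : kˣ → ℂ) (z * a⁻¹) = _
    by_cases hz : z = y * a
    · subst hz
      simp
    · have hz' : z * a⁻¹ ≠ y := fun e => hz (by rw [← e, inv_mul_cancel_right])
      simp [hz, hz']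
  change χ ((x : k) * b) * T ((piRep χ a b).symm (Pi.single y 1)) (x * a) = _
  rw [hsymm, map_smul, Pi.smul_apply, smul_eq_mul, ← mul_assoc, ← AddChar.map_add_eq_mul]
  congr 2
  ring

/-- The matrix entries of an operator, extended by zero to `k × k`. -/
def extEntry (T : Module.End ℂ (kˣ → ℂ)) (x y : k) : ℂ :=
  if h : x ≠ 0 ∧ y ≠ 0 then entry T (Units.mk0 x h.1) (Units.mk0 y h.2) else 0

lemma extEntry_coe (T : Module.End ℂ (kˣ → ℂ)) (x y : kˣ) :
    extEntry T x y = entry T x y := by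
  simp [extEntry]

lemma extEntry_zero_left (T : Module.End ℂ (kˣ → ℂ)) (y : k) : extEntry T 0 y = 0 := by
  simp [extEntry]

lemma extEntry_zero_right (T : Module.End ℂ (kˣ → ℂ)) (x : k) : extEntry T x 0 = 0 := by
  simp [extEntry]

lemma extEntry_conj (χ : AddChar k ℂ) (T : Module.End ℂ (kˣ → ℂ)) (a : kˣ) (x y : k) :
    extEntry ((piRep χ a 0).toLinearMap * T * (piRep χ a 0).symm.toLinearMap) x y =
      extEntry T (x * a) (y * a) := by
  by_cases hx : x = 0
  · simp [hx, extEntry_zero_left]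
  by_cases hy : y = 0
  · simp [hy, extEntry_zero_right]
  lift x to kˣ using Ne.isUnit hx
  lift y to kˣ using Ne.isUnit hy
  rw [← Units.val_mul, ← Units.val_mul, extEntry_coe, extEntry_coe, entry_conj]
  simp

variable [Fintype k]

lemma apply_eq_sum_entry (T : Module.End ℂ (kˣ → ℂ)) (F : kˣ → ℂ) (x : kˣ) :
    T F x = ∑ y, entry T x y * F y := by
  rw [LinearMap.pi_apply_eq_sum_univ T F, Finset.sum_apply]
  refine Finset.sum_congr rfl fun y _ => ?_
  rw [Pi.smul_apply, smul_eq_mul, mul_comm]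
  have e : (fun j => if y = j then 1 else 0 : kˣ → ℂ) = Pi.single y 1 := by
    funext z
    simp [Pi.single_apply, eq_comm]
  rw [e]
  rfl

lemma entry_mul (S T : Module.End ℂ (kˣ → ℂ)) (x y : kˣ) :
    entry (S * T) x y = ∑ z, entry S x z * entry T z y :=
  apply_eq_sum_entry S (T (Pi.single y 1)) x

/-- An operator with vanishing off-diagonal entries is a multiplication operator. -/
lemma eq_mulOp_of_entry_eq_zero {T : Module.End ℂ (kˣ → ℂ)}
    (h : ∀ x y, x ≠ y → entry T x y = 0) : T = mulOp (fun x => entry T x x) := by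
  refine LinearMap.ext fun F => funext fun x => ?_
  rw [apply_eq_sum_entry, Finset.sum_eq_single x]
  · rfl
  · intro y _ hy
    rw [h x y hy.symm, zero_mul]
  · simp

lemma extEntry_mul (S T : Module.End ℂ (kˣ → ℂ)) (x y : k) :
    extEntry (S * T) x y = ∑ z, extEntry S x z * extEntry T z y := by
  by_cases hx : x = 0
  · simp [hx, extEntry_zero_left]
  by_cases hy : y = 0
  · simp [hy, extEntry_zero_right]
  lift x to kˣ using Ne.isUnit hx
  lift y to kˣ using Ne.isUnit hy
  rw [extEntry_coe, entry_mul]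
  refine Finset.sum_of_injOn (fun z : kˣ => (z : k)) Units.val_injective.injOn (by simp) ?_ ?_
  · intro z _ hz
    have : z = 0 := by
      by_contra h
      exact hz ⟨Units.mk0 z h, by simp, rfl⟩
    rw [this, extEntry_zero_left, mul_zero]
  · intro z _
    simp only [extEntry_coe]

/-- In an inductive algebra, an operator of nonzero weight vanishes. -/
lemma entry_eq_zero_of_weight {χ : AddChar k ℂ} {A : Subalgebra ℂ (Module.End ℂ (kˣ → ℂ))}
    (hA : IsInductive χ A) {T : Module.End ℂ (kˣ → ℂ)} (hT : T ∈ A) {b : k} (hb : b ≠ 0)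
    (hsupp : ∀ x y : kˣ, (x : k) - y ≠ b → entry T x y = 0) (x y : kˣ) : entry T x y = 0 := by
  have hext : ∀ x y : k, x - y ≠ b → extEntry T x y = 0 := by
    intro x y hxy
    unfold extEntry
    split_ifs with h
    · exact hsupp _ _ hxy
    · rfl
  have hprod : ∀ u v : kˣ, ∑ z, extEntry T (b * u) (z * u) *
        extEntry T (z * v) ((b - b / u - b / v) * v) =
      extEntry T (b * u) (b * u - b) *
        extEntry T (b * ((v : k) - v / u)) (b * ((v : k) - v / u) - b) := by
    intro u v
    have hu := u.ne_zero
    have hv := v.ne_zero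
    rw [Finset.sum_eq_single (b - b / u)]
    · congr 2 <;> field_simp
    · intro z _ hz
      rw [hext _ (z * u), zero_mul]
      intro e
      apply hz
      field_simp
      linear_combination -e
    · simp
  have key : ∀ w : k, extEntry T (b * w) (b * w - b) = 0 := by
    refine eq_zero_of_functional_equation (t := fun w => extEntry T (b * w) (b * w - b)) ?_ ?_ ?_
    · simp [extEntry_zero_left]
    · simp [extEntry_zero_right]
    · intro u v hu hv
      lift u to kˣ using Ne.isUnit hu
      lift v to kˣ using Ne.isUnit hv
      have hcomm := congrArg (fun S => extEntry S b (b - b / u - b / v))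
        (hA.1 _ (hA.2 T hT u 0) _ (hA.2 T hT v 0))
      beta_reduce at hcomm
      rw [extEntry_mul, extEntry_mul] at hcomm
      simp only [extEntry_conj] at hcomm
      rw [hprod u v, sub_right_comm b (b / (u : k)), hprod v u] at hcomm
      exact hcomm
  by_cases hxy : (x : k) - y = b
  · have e := key (x / b)
    rwa [mul_div_cancel₀ _ hb, ← hxy, sub_sub_cancel, extEntry_coe] at e
  · exact hsupp x y hxy

/-- The off-diagonal entries of the elements of an inductive algebra vanish. -/
lemma IsInductive.entry_eq_zero {χ : AddChar k ℂ} (hχ : χ ≠ 1)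
    {A : Subalgebra ℂ (Module.End ℂ (kˣ → ℂ))} (hA : IsInductive χ A)
    {T : Module.End ℂ (kˣ → ℂ)} (hT : T ∈ A) {x y : kˣ} (hxy : x ≠ y) : entry T x y = 0 := by
  set b : k := x - y
  have hb : b ≠ 0 := sub_ne_zero.2 fun e => hxy (Units.ext e)
  set P : Module.End ℂ (kˣ → ℂ) := ∑ c : k, χ (c * -b) •
    ((piRep χ 1 c).toLinearMap * T * (piRep χ 1 c).symm.toLinearMap)
  have hP : P ∈ A := sum_mem fun c _ => A.smul_mem (hA.2 T hT 1 c) _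
  have hentry : ∀ x' y' : kˣ, entry P x' y' =
      (if (x' : k) - y' - b = 0 then (Fintype.card k : ℂ) else 0) * entry T x' y' := by
    intro x' y'
    have hsum := AddChar.sum_mulShift ((x' : k) - y' - b) (AddChar.IsPrimitive.of_ne_one hχ)
    push_cast at hsum
    rw [← hsum, Finset.sum_mul]
    have e : entry P x' y' = ∑ c : k, χ (c * -b) *
        entry ((piRep χ 1 c).toLinearMap * T * (piRep χ 1 c).symm.toLinearMap) x' y' := by
      simp [entry, P, LinearMap.sum_apply, Finset.sum_apply]
    rw [e]
    refine Finset.sum_congr rfl fun c _ => ?_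
    rw [entry_conj, mul_one, mul_one, ← mul_assoc, ← AddChar.map_add_eq_mul]
    congr 2
    ring
  have hz := entry_eq_zero_of_weight hA hP hb (fun x' y' h => by
    rw [hentry, if_neg (sub_ne_zero.2 h), zero_mul]) x y
  rw [hentry, if_pos (sub_self b)] at hz
  exact (mul_eq_zero.1 hz).resolve_left (Nat.cast_ne_zero.2 Fintype.card_ne_zero)

end Entries

/-- The algebra of multiplication operators. -/
def mulOpSubalgebra (k : Type*) [Field k] : Subalgebra ℂ (Module.End ℂ (kˣ → ℂ)) where
  carrier := Set.range mulOp
  mul_mem' := by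
    rintro _ _ ⟨φ, rfl⟩ ⟨ψ, rfl⟩
    exact ⟨φ * ψ, LinearMap.ext fun F => funext fun x => mul_assoc _ _ _⟩
  add_mem' := by
    rintro _ _ ⟨φ, rfl⟩ ⟨ψ, rfl⟩
    exact ⟨φ + ψ, LinearMap.ext fun F => funext fun x => add_mul _ _ _⟩
  algebraMap_mem' c := ⟨fun _ => c, rfl⟩

lemma isInductive_mulOpSubalgebra (χ : AddChar k ℂ) : IsInductive χ (mulOpSubalgebra k) := by
  constructor
  · rintro _ ⟨φ, rfl⟩ _ ⟨ψ, rfl⟩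
    exact LinearMap.ext fun F => funext fun x => mul_left_comm _ _ _
  · rintro _ ⟨φ, rfl⟩ a b
    refine ⟨fun x => φ (x * a), LinearMap.ext fun F => funext fun x => ?_⟩
    have e := congrFun ((piRep χ a b).apply_symm_apply F) x
    change φ (x * a) * F x = χ ((x : k) * b) * (φ (x * a) * (piRep χ a b).symm F (x * a))
    conv_lhs => rw [← e]
    exact mul_left_comm _ _ _

/-- Every maximal `π`-inductive algebra equals `B`, the algebra of
multiplication operators; in particular there is a unique maximal inductive algebra
and it is self-adjoint. -/
theorem unique_maximal_inductive_algebra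
    {k : Type*} [Field k] [Fintype k] [DecidableEq k]
    (χ : AddChar k ℂ) (hχ : χ ≠ 1)
    (A : Subalgebra ℂ (Module.End ℂ (kˣ → ℂ)))
    (hA : IsInductive χ A)
    (hmax : ∀ A' : Subalgebra ℂ (Module.End ℂ (kˣ → ℂ)),
      IsInductive χ A' → A ≤ A' → A' = A) :
    (A : Set (Module.End ℂ (kˣ → ℂ))) = Set.range (mulOp (k := k)) ∧
      ∀ T ∈ A, ∃ S ∈ A, ∀ F G : kˣ → ℂ, inn (T F) G = inn F (S G) := by
  have hB : mulOpSubalgebra k = A :=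
    hmax _ (isInductive_mulOpSubalgebra χ) fun T hT =>
      ⟨_, (eq_mulOp_of_entry_eq_zero fun _ _ h => hA.entry_eq_zero hχ hT h).symm⟩
  subst hB
  refine ⟨rfl, ?_⟩
  rintro _ ⟨φ, rfl⟩
  refine ⟨_, ⟨fun x => starRingEnd ℂ (φ x), rfl⟩, fun F G => Finset.sum_congr rfl fun x _ => ?_⟩
  change φ x * F x * starRingEnd ℂ (G x) = F x * starRingEnd ℂ (starRingEnd ℂ (φ x) * G x)
  rw [map_mul, Complex.conj_conj]
  ring

end AffineInductive
end

section
/- Every π-inductive algebra is contained in B, the algebra of multiplication operators. -/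
open scoped BigOperators

namespace AffineInductive

variable {k : Type*} [Field k]

open LinearMap Polynomial

lemma toMatrix'_piRep_conj [Fintype k] [DecidableEq k] (χ : AddChar k ℂ)
    (T : Module.End ℂ (kˣ → ℂ)) (a : kˣ) (b : k) (x y : kˣ) :
    toMatrix' ((piRep χ a b).toLinearMap * T * (piRep χ a b).symm.toLinearMap) x y =
      χ (((x : k) - y) * b) * toMatrix' T (x * a) (y * a) := by
  have h : (piRep χ a b).symm (Pi.single y 1) =
      χ (-((y : k) * b)) • (Pi.single (y * a) 1 : kˣ → ℂ) := by
    funext z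
    change χ (-(((z * a⁻¹ : kˣ) : k) * b)) * (Pi.single y 1 : kˣ → ℂ) (z * a⁻¹) = _
    by_cases hz : z = y * a
    · subst hz
      simp
    · have : z * a⁻¹ ≠ y := fun h => hz (by rw [← h, inv_mul_cancel_right])
      simp [hz, this]
  simp only [toMatrix'_apply, Module.End.mul_apply, LinearEquiv.coe_coe, h, map_smul]
  change χ (-((y : k) * b)) * (χ ((x : k) * b) * _) = _
  rw [← mul_assoc, ← AddChar.map_add_eq_mul]
  congr 2
  ring

/-- The translation operators `F ↦ F(· * a)`. -/
def translation (k : Type*) [Field k] : kˣ →* Module.End ℂ (kˣ → ℂ) where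
  toFun a := LinearMap.funLeft ℂ ℂ (· * a)
  map_one' := by ext; simp [LinearMap.funLeft]
  map_mul' a b := by
    ext F x
    simp only [Module.End.mul_apply, LinearMap.funLeft_apply]
    congr 1
    rw [mul_comm a b, mul_assoc, mul_comm a b]

lemma commute_translation_iff [Fintype k] [DecidableEq k] (T : Module.End ℂ (kˣ → ℂ)) (a : kˣ) :
    Commute T (translation k a) ↔
      ∀ x y, toMatrix' T (x * a) (y * a) = toMatrix' T x y := by
  have hs (y : kˣ) : translation k a (Pi.single (y * a) 1) = Pi.single y 1 := by
    funext z
    simp [translation, LinearMap.funLeft_apply, Pi.single_apply]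
  constructor
  · intro h x y
    have := congrFun (LinearMap.congr_fun h.eq (Pi.single (y * a) 1)) x
    simp only [Module.End.mul_apply, hs] at this
    simp only [toMatrix'_apply]
    exact this.symm
  · intro h
    refine LinearMap.pi_ext' fun y => LinearMap.ext_ring ?_
    funext x
    have hx := h x (y * a⁻¹)
    rw [inv_mul_cancel_right] at hx
    simp only [toMatrix'_apply] at hx
    have := hs (y * a⁻¹)
    rw [inv_mul_cancel_right] at this
    simp only [LinearMap.comp_apply, LinearMap.single_apply, Module.End.mul_apply, this]
    exact hx.symm

lemma eq_sum_translation [Fintype k] [DecidableEq k] (T : Module.End ℂ (kˣ → ℂ))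
    (hT : ∀ a, Commute T (translation k a)) :
    T = ∑ m : kˣ, toMatrix' T 1 m • translation k m := by
  refine LinearMap.pi_ext' fun y => LinearMap.ext_ring ?_
  funext x
  have h := (commute_translation_iff T x).1 (hT x) 1 (x⁻¹ * y)
  rw [one_mul, mul_comm x⁻¹, inv_mul_cancel_right] at h
  have hm (m : kˣ) : x * m = y ↔ m = y * x⁻¹ := by
    rw [eq_mul_inv_iff_mul_eq, mul_comm]
  simp only [toMatrix'_apply] at h
  simp [translation, LinearMap.funLeft_apply, Pi.single_apply, hm, h, toMatrix'_apply]

lemma isSemisimple_of_pow_eq_one {V : Type*} [AddCommGroup V] [Module ℂ V]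
    {f : Module.End ℂ V} {n : ℕ} (hn : n ≠ 0) (hf : f ^ n = 1) : f.IsSemisimple := by
  refine Module.End.isSemisimple_of_squarefree_aeval_eq_zero
    (p := X ^ n - C 1) (separable_X_pow_sub_C 1 (Nat.cast_ne_zero.2 hn) one_ne_zero).squarefree ?_
  rw [map_sub, map_pow, aeval_X, hf, aeval_C, map_one, sub_self]

lemma isSemisimple_of_commute_translation [Fintype k] [DecidableEq k]
    (T : Module.End ℂ (kˣ → ℂ)) (hT : ∀ a, Commute T (translation k a)) : T.IsSemisimple := by
  obtain ⟨g, hg⟩ := IsCyclic.exists_monoid_generator (α := kˣ)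
  have hss : (translation k g).IsSemisimple :=
    isSemisimple_of_pow_eq_one (n := Fintype.card kˣ) Fintype.card_ne_zero
      (by rw [← map_pow, pow_card_eq_one, map_one])
  suffices hmem : T ∈ Algebra.adjoin ℂ {translation k g} from hss.of_mem_adjoin_singleton hmem
  rw [eq_sum_translation T hT]
  refine sum_mem fun m _ => Subalgebra.smul_mem _ ?_ _
  obtain ⟨n, rfl⟩ := hg m
  rw [map_pow]
  exact pow_mem (Algebra.self_mem_adjoin_singleton ℂ _) n

lemma trace_eq_sum [Fintype k] [DecidableEq k] (T : Module.End ℂ (kˣ → ℂ)) :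
    LinearMap.trace ℂ _ T = ∑ x, toMatrix' T x x := by
  rw [LinearMap.trace_eq_matrix_trace ℂ (Pi.basisFun ℂ kˣ)]
  rfl

lemma sum_units_char [Fintype k] [DecidableEq k] {χ : AddChar k ℂ} (hχ : χ ≠ 1) (d : k) :
    ∑ x : kˣ, χ ((x : k) * d) = (if d = 0 then (Fintype.card k : ℂ) else 0) - 1 := by
  have h := AddChar.sum_mulShift d (AddChar.IsPrimitive.of_ne_one hχ)
  rw [← Finset.add_sum_erase _ _ (Finset.mem_univ (0 : k))] at h
  have h2 : ∑ x : kˣ, χ ((x : k) * d) = ∑ x ∈ Finset.univ.erase (0 : k), χ (x * d) := by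
    refine Finset.sum_bij (fun x _ => (x : k)) ?_ ?_ ?_ ?_
    · intro x _; simp
    · intro x _ y _ h; exact Units.ext h
    · intro x hx; exact ⟨Units.mk0 x (Finset.ne_of_mem_erase hx), by simp, rfl⟩
    · intro x _; rfl
  rw [h2, ← add_sub_cancel_left (χ (0 * d)) (∑ x ∈ _, _), h]
  simp

lemma exists_trace_eq_natCast {V : Type*} [AddCommGroup V] [Module ℂ V] [FiniteDimensional ℂ V]
    {P : Module.End ℂ V} (hP : IsIdempotentElem P) : ∃ n : ℕ, LinearMap.trace ℂ V P = n ∧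
      n ≤ Module.finrank ℂ V :=
  ⟨_, hP.isProj_range.trace, Submodule.finrank_le _⟩

lemma dvd_of_succ_mul_sq {N n t : ℕ} (hN : 0 < N)
    (h : (N + 1) * n ^ 2 = n * N + t * N ^ 2) : N ∣ n := by
  obtain ⟨g, N', n', hg, hco, rfl, rfl⟩ := Nat.exists_coprime' (m := N) (n := n)
    (Nat.gcd_pos_of_pos_left _ hN)
  have h1 : (N' * g + 1) * n' ^ 2 = n' * N' + t * N' ^ 2 := by
    refine Nat.eq_of_mul_eq_mul_left (pow_pos hg 2) ?_
    linear_combination h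
  have h2 : N' ∣ n' ^ 2 := by
    have h3 : N' ∣ N' * (g * n' ^ 2) + n' ^ 2 :=
      ⟨n' + t * N', by linear_combination h1⟩
    exact (Nat.dvd_add_right (dvd_mul_right _ _)).1 h3
  have h4 : N' = 1 := Nat.Coprime.eq_one_of_dvd (hco.pow_right 2) h2
  subst h4
  simp

lemma trace_mul_piRep_conj [Fintype k] [DecidableEq k] {χ : AddChar k ℂ} (hχ : χ ≠ 1)
    {P : Module.End ℂ (kˣ → ℂ)} (hP : IsIdempotentElem P)
    (hT : ∀ a, Commute P (translation k a)) :
    (Fintype.card kˣ : ℂ) ^ 2 * LinearMap.trace ℂ _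
      (P * ((piRep χ 1 1).toLinearMap * P * (piRep χ 1 1).symm.toLinearMap)) =
    (Fintype.card kˣ + 1) * LinearMap.trace ℂ _ P ^ 2
      - Fintype.card kˣ * LinearMap.trace ℂ _ P := by
  set p : kˣ → ℂ := fun m => toMatrix' P 1 m with hp
  have hPp (x m : kˣ) : toMatrix' P x (m * x) = p m := by
    simpa [hp] using (commute_translation_iff P x).1 (hT x) 1 m
  have hPp' (x m : kˣ) : toMatrix' P (m * x) x = p m⁻¹ := by
    simpa [hp] using (commute_translation_iff P (m * x)).1 (hT _) 1 m⁻¹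
  have htr : LinearMap.trace ℂ _ P = Fintype.card kˣ * p 1 := by
    rw [trace_eq_sum]
    have (x : kˣ) : toMatrix' P x x = p 1 := by simpa using hPp x 1
    simp [this]
  have hsq : ∑ m, p m * p m⁻¹ = p 1 := by
    have h := congrArg (fun T => toMatrix' T 1 1) hP.eq
    simp only [LinearMap.toMatrix'_mul, Matrix.mul_apply] at h
    change _ = toMatrix' P 1 1
    rw [← h]
    refine Finset.sum_congr rfl fun m _ => ?_
    congr 1
    simpa using (hPp' 1 m).symm
  have hq : (Fintype.card k : ℂ) = Fintype.card kˣ + 1 := by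
    rw [Fintype.card_eq_card_units_add_one]; push_cast; rfl
  have key : LinearMap.trace ℂ _
      (P * ((piRep χ 1 1).toLinearMap * P * (piRep χ 1 1).symm.toLinearMap)) =
      (Fintype.card kˣ + 1) * p 1 ^ 2 - p 1 := by
    rw [trace_eq_sum]
    calc _ = ∑ x : kˣ, ∑ m : kˣ, p m * p m⁻¹ * χ ((x : k) * ((m : k) - 1)) := by
          refine Finset.sum_congr rfl fun x _ => ?_
          rw [LinearMap.toMatrix'_mul, Matrix.mul_apply,
            ← Equiv.sum_comp (Equiv.mulRight x)]
          refine Finset.sum_congr rfl fun m _ => ?_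
          change toMatrix' P x (m * x) * toMatrix' _ (m * x) x = _
          rw [toMatrix'_piRep_conj, mul_one, mul_one, mul_one, hPp, hPp']
          rw [show ((m * x : kˣ) : k) - x = (x : k) * ((m : k) - 1) by push_cast; ring]
          ring
      _ = ∑ m : kˣ, p m * p m⁻¹ * ((if m = 1 then (Fintype.card k : ℂ) else 0) - 1) := by
          rw [Finset.sum_comm]
          refine Finset.sum_congr rfl fun m _ => ?_
          rw [← Finset.mul_sum, sum_units_char hχ]
          simp [sub_eq_zero]
      _ = _ := by
          simp only [mul_sub, mul_one, Finset.sum_sub_distrib, hsq, mul_ite, mul_zero,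
            Finset.sum_ite_eq', Finset.mem_univ, if_true, inv_one, hq]
          ring
  rw [key, htr]
  ring

lemma IsInductive.idempotent_eq_zero_or_one [Fintype k] [DecidableEq k] {χ : AddChar k ℂ} (hχ : χ ≠ 1)
    {A : Subalgebra ℂ (Module.End ℂ (kˣ → ℂ))} (hA : IsInductive χ A)
    {P : Module.End ℂ (kˣ → ℂ)} (hPA : P ∈ A) (hP : IsIdempotentElem P)
    (hT : ∀ a, Commute P (translation k a)) : P = 0 ∨ P = 1 := by
  set Q := (piRep χ 1 1).toLinearMap * P * (piRep χ 1 1).symm.toLinearMap with hQ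
  have hQi : IsIdempotentElem Q := by
    have h1 : (piRep χ 1 1).symm.toLinearMap * (piRep χ 1 1).toLinearMap = 1 := by
      exact LinearMap.ext fun F => (piRep χ 1 1).symm_apply_apply F
    calc Q * Q = (piRep χ 1 1).toLinearMap * P *
          ((piRep χ 1 1).symm.toLinearMap * (piRep χ 1 1).toLinearMap) * P *
          (piRep χ 1 1).symm.toLinearMap := by simp only [hQ, mul_assoc]
      _ = Q := by rw [h1, mul_one, mul_assoc _ P P, hP.eq]
  have hcomm : Commute P Q := hA.1 P hPA Q (hA.2 P hPA 1 1)
  obtain ⟨t, ht, -⟩ := exists_trace_eq_natCast (IsIdempotentElem.mul_of_commute hcomm hP hQi)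
  obtain ⟨n, hn, hle⟩ := exists_trace_eq_natCast hP
  have hN : 0 < Fintype.card kˣ := Fintype.card_pos
  rw [Module.finrank_fintype_fun_eq_card] at hle
  have hmain := trace_mul_piRep_conj hχ hP hT
  rw [← hQ, ht, hn] at hmain
  have hdvd : Fintype.card kˣ ∣ n := by
    refine dvd_of_succ_mul_sq (t := t) hN ?_
    have : ((Fintype.card kˣ : ℂ) + 1) * n ^ 2 =
        n * Fintype.card kˣ + t * (Fintype.card kˣ : ℂ) ^ 2 := by
      linear_combination -hmain
    exact_mod_cast this
  rcases Nat.eq_zero_or_pos n with h0 | hpos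
  · left
    refine hP.trace_eq_zero_iff.1 ?_
    rw [hn, h0, Nat.cast_zero]
  · right
    have hnN : n = Fintype.card kˣ := le_antisymm hle (Nat.le_of_dvd hpos hdvd)
    refine (sub_eq_zero.1 (hP.one_sub.trace_eq_zero_iff.1 ?_)).symm
    rw [map_sub, hn, LinearMap.trace_one, Module.finrank_fintype_fun_eq_card, hnN, sub_self]

lemma aeval_mem_subalgebra {R E : Type*} [CommRing R] [Ring E] [Algebra R E]
    {B : Subalgebra R E} {x : E} (hx : x ∈ B) (f : R[X]) : aeval x f ∈ B :=
  Algebra.adjoin_le (Set.singleton_subset_iff.2 hx) (aeval_mem_adjoin_singleton R x)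

lemma IsInductive.eq_algebraMap_of_commute_translation [Fintype k] [DecidableEq k] {χ : AddChar k ℂ}
    (hχ : χ ≠ 1) {A : Subalgebra ℂ (Module.End ℂ (kˣ → ℂ))} (hA : IsInductive χ A)
    {T : Module.End ℂ (kˣ → ℂ)} (hTA : T ∈ A) (hT : ∀ a, Commute T (translation k a)) :
    ∃ c : ℂ, T = algebraMap ℂ _ c := by
  obtain ⟨c, hc⟩ := Module.End.exists_eigenvalue T
  obtain ⟨h, hh⟩ := dvd_iff_isRoot.2 (Module.End.isRoot_of_hasEigenvalue hc)
  have hsq := (isSemisimple_of_commute_translation T hT).minpoly_squarefree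
  have hne : minpoly ℂ T ≠ 0 := minpoly.ne_zero (Algebra.IsIntegral.isIntegral T)
  have hroot : h.eval c ≠ 0 := by
    intro h0
    obtain ⟨r, rfl⟩ := dvd_iff_isRoot.2 h0
    refine not_isUnit_X_sub_C c (hsq _ ⟨r, ?_⟩)
    rw [hh, mul_assoc]
  have hzero : (T - algebraMap ℂ _ c) * aeval T h = 0 := by
    have := minpoly.aeval ℂ T
    rw [hh] at this
    simpa using this
  have hmul : aeval T h * aeval T h = h.eval c • aeval T h := by
    obtain ⟨r, hr⟩ := X_sub_C_dvd_sub_C_eval (p := h) (a := c)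
    have : aeval T h = aeval T r * (T - algebraMap ℂ _ c) + algebraMap ℂ _ (h.eval c) := by
      have := congrArg (aeval T) hr
      rw [mul_comm] at this
      simpa [sub_eq_iff_eq_add] using this
    conv_lhs => enter [1]; rw [this]
    rw [add_mul, mul_assoc, hzero, mul_zero, zero_add, Algebra.smul_def]
  have hidem : IsIdempotentElem ((h.eval c)⁻¹ • aeval T h) := by
    rw [IsIdempotentElem, smul_mul_smul_comm, hmul, smul_smul, mul_assoc,
      inv_mul_cancel₀ hroot, mul_one]
  have hmem : (h.eval c)⁻¹ • aeval T h ∈ A :=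
    A.smul_mem (aeval_mem_subalgebra hTA h) _
  have hcomm (a : kˣ) : Commute ((h.eval c)⁻¹ • aeval T h) (translation k a) :=
    by
    refine Commute.smul_left (Commute.symm ?_) _
    have hc : T ∈ Subalgebra.centralizer ℂ {translation k a} := by
      simpa [Subalgebra.mem_centralizer_iff] using (hT a).symm.eq
    exact Subalgebra.mem_centralizer_iff ℂ |>.1 (aeval_mem_subalgebra hc h) _ rfl
  rcases hA.idempotent_eq_zero_or_one hχ hmem hidem hcomm with h0 | h1
  · exfalso
    have h2 : aeval T h = 0 := (smul_eq_zero.1 h0).resolve_left (inv_ne_zero hroot)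
    have h3 : h ≠ 0 := fun h' => hne (by rw [hh, h', mul_zero])
    have h4 := natDegree_le_of_dvd (minpoly.dvd ℂ T h2) h3
    rw [hh, natDegree_mul (X_sub_C_ne_zero c) h3, natDegree_X_sub_C] at h4
    omega
  · refine ⟨c, sub_eq_zero.1 ?_⟩
    rw [← mul_one (T - _), ← h1, mul_smul_comm, hzero, smul_zero]

lemma IsInductive.toMatrix'_eq_zero [Fintype k] [DecidableEq k] {χ : AddChar k ℂ}
    (hχ : χ ≠ 1) {A : Subalgebra ℂ (Module.End ℂ (kˣ → ℂ))} (hA : IsInductive χ A)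
    {T : Module.End ℂ (kˣ → ℂ)} (hTA : T ∈ A) {x y : kˣ} (hxy : x ≠ y) :
    toMatrix' T x y = 0 := by
  set c : k := x - y with hc
  have hc0 : c ≠ 0 := fun h => hxy (Units.ext (sub_eq_zero.1 h))
  set V : Module.End ℂ (kˣ → ℂ) := ∑ a : kˣ, ∑ b : k, χ (-(c * b)) •
    ((piRep χ a (a * b)).toLinearMap * T * (piRep χ a (a * b)).symm.toLinearMap) with hV
  have hVA : V ∈ A := sum_mem fun a _ => sum_mem fun b _ => A.smul_mem (hA.2 T hTA _ _) _
  have hent (z w : kˣ) : toMatrix' V z w = ∑ a : kˣ,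
      (if ((z * a : kˣ) : k) - (w * a : kˣ) = c then (Fintype.card k : ℂ) else 0) *
        toMatrix' T (z * a) (w * a) := by
    simp only [hV, map_sum, map_smul, Matrix.sum_apply, Matrix.smul_apply,
      smul_eq_mul]
    refine Finset.sum_congr rfl fun a _ => ?_
    have h := AddChar.sum_mulShift (((z * a : kˣ) : k) - (w * a : kˣ) - c)
      (AddChar.IsPrimitive.of_ne_one hχ)
    simp only [sub_eq_zero (b := c)] at h
    push_cast at h ⊢
    rw [← h, Finset.sum_mul]
    refine Finset.sum_congr rfl fun b _ => ?_
    rw [toMatrix'_piRep_conj, ← mul_assoc, ← AddChar.map_add_eq_mul]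
    congr 2
    ring
  have hVT (a : kˣ) : Commute V (translation k a) := by
    refine (commute_translation_iff V a).2 fun z w => ?_
    rw [hent, hent z w]
    simp only [mul_assoc]
    exact Equiv.sum_comp (Equiv.mulLeft a) fun a' : kˣ =>
      (if ((z * a' : kˣ) : k) - (w * a' : kˣ) = c then (Fintype.card k : ℂ) else 0) *
        toMatrix' T (z * a') (w * a')
  obtain ⟨d, hd⟩ := hA.eq_algebraMap_of_commute_translation hχ hVA hVT
  have h0 : toMatrix' V x y = 0 := by
    rw [hd, toMatrix'_apply]
    simp [Module.algebraMap_end_apply, hxy]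
  rw [hent, Finset.sum_eq_single 1] at h0
  · simpa [hc] using h0
  · intro a _ ha
    rw [if_neg, zero_mul]
    intro h
    push_cast at h
    rw [← sub_mul, ← hc, mul_eq_left₀ hc0] at h
    exact ha (Units.ext h)
  · simp

/-- Every `π`-inductive algebra is contained in `B`, the algebra of
multiplication operators. -/
theorem inductive_algebra_subset_mult
    {k : Type*} [Field k] [Fintype k]
    (χ : AddChar k ℂ) (hχ : χ ≠ 1)
    (A : Subalgebra ℂ (Module.End ℂ (kˣ → ℂ)))
    (hA : IsInductive χ A) :
    (A : Set (Module.End ℂ (kˣ → ℂ))) ⊆ Set.range (mulOp (k := k)) := by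
  classical
  intro T hT
  refine ⟨fun x => toMatrix' T x x, ?_⟩
  refine LinearMap.pi_ext' fun y => LinearMap.ext_ring ?_
  funext x
  change toMatrix' T x x * (Pi.single y 1 : kˣ → ℂ) x = toMatrix' T x y
  by_cases hxy : x = y
  · subst hxy
    simp
  · rw [hA.toMatrix'_eq_zero hχ hT hxy]
    simp [hxy]

end AffineInductive
end

section
/- If A is a π-inductive algebra, then A contains no non-zero nilpotent elements: if T ∈ A and T^m = 0 for some m, then T = 0. -/
open scoped BigOperators

namespace AffineInductive

variable {k : Type*} [Field k]

/-- A finite family of commuting nilpotent endomorphisms has a common nonzero kernel vector. -/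
lemma exists_ne_zero_forall_mem_finset_apply_eq_zero {R V : Type*} [CommRing R] [AddCommGroup V]
    [Module R V] [Nontrivial V] (s : Finset (Module.End R V))
    (hcomm : ∀ S ∈ s, ∀ T ∈ s, Commute S T) (hnil : ∀ S ∈ s, IsNilpotent S) :
    ∃ v : V, v ≠ 0 ∧ ∀ S ∈ s, S v = 0 := by
  classical
  induction s using Finset.induction_on with
  | empty => simpa using exists_ne (0 : V)
  | insert T s _ ih =>
    obtain ⟨v, hv, hs⟩ := ih
      (fun S hS S' hS' => hcomm S (Finset.mem_insert_of_mem hS) S' (Finset.mem_insert_of_mem hS'))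
      (fun S hS => hnil S (Finset.mem_insert_of_mem hS))
    have hex : ∃ n : ℕ, (T ^ n) v = 0 := by
      obtain ⟨n, hn⟩ := hnil T (Finset.mem_insert_self T s)
      exact ⟨n, by simp [hn]⟩
    obtain ⟨n, hn⟩ : ∃ n, Nat.find hex = n + 1 :=
      Nat.exists_eq_succ_of_ne_zero fun h => hv (by simpa [h] using Nat.find_spec hex)
    refine ⟨(T ^ n) v, Nat.find_min hex (by omega), fun S hS => ?_⟩
    rcases Finset.mem_insert.mp hS with rfl | hS'
    · rw [← Module.End.mul_apply, ← pow_succ', ← hn]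
      exact Nat.find_spec hex
    · have h := (hcomm S hS T (Finset.mem_insert_self T s)).pow_right n
      rw [← Module.End.mul_apply, h.eq, Module.End.mul_apply, hs S hS', map_zero]

/-- A set of commuting nilpotent endomorphisms of a finite-dimensional space has a common nonzero
kernel vector. -/
lemma exists_ne_zero_forall_mem_apply_eq_zero {K V : Type*} [Field K] [AddCommGroup V]
    [Module K V] [Nontrivial V] [FiniteDimensional K V] (N : Set (Module.End K V))
    (hcomm : ∀ S ∈ N, ∀ T ∈ N, Commute S T) (hnil : ∀ S ∈ N, IsNilpotent S) :
    ∃ v : V, v ≠ 0 ∧ ∀ S ∈ N, S v = 0 := by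
  obtain ⟨s, hsN, hspan⟩ := (Submodule.fg_span_iff_fg_span_finset_subset N).mp
    (IsNoetherian.noetherian (Submodule.span K N))
  obtain ⟨v, hv, hs⟩ := exists_ne_zero_forall_mem_finset_apply_eq_zero s
    (fun S hS T hT => hcomm S (hsN hS) T (hsN hT)) (fun S hS => hnil S (hsN hS))
  refine ⟨v, hv, fun S hS => ?_⟩
  have hle : Submodule.span K (s : Set (Module.End K V)) ≤
      LinearMap.ker (LinearMap.applyₗ v : Module.End K V →ₗ[K] V) :=
    Submodule.span_le.mpr fun S hS => hs S hS
  exact hle (hspan ▸ Submodule.subset_span hS)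

lemma piRep_apply (χ : AddChar k ℂ) (a : kˣ) (b : k) (F : kˣ → ℂ) (x : kˣ) :
    piRep χ a b F x = χ ((x : k) * b) * F (x * a) := rfl

lemma piRep_symm (χ : AddChar k ℂ) (a : kˣ) (b : k) :
    (piRep χ a b).symm = piRep χ a⁻¹ (-((a⁻¹ : kˣ) * b)) := by
  refine LinearEquiv.ext fun F => funext fun x => ?_
  change χ (-(((x * a⁻¹ : kˣ) : k) * b)) * F (x * a⁻¹) = _
  rw [piRep_apply, Units.val_mul, mul_neg, mul_assoc]

/-- The representation `π` is irreducible: a nonzero invariant subspace is everything. -/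
lemma eq_top_of_piRep_invariant [Fintype k] {χ : AddChar k ℂ} (hχ : χ ≠ 1)
    (W : Submodule ℂ (kˣ → ℂ)) (hW : ∀ F ∈ W, ∀ (a : kˣ) (b : k), piRep χ a b F ∈ W)
    (hne : W ≠ ⊥) : W = ⊤ := by
  classical
  obtain ⟨F, hF, hF0⟩ := W.exists_mem_ne_zero_of_ne_bot hne
  obtain ⟨y, hy⟩ := Function.ne_iff.mp hF0
  have hprim : χ.IsPrimitive := AddChar.IsPrimitive.of_ne_one hχ
  have hsum : ∑ b : k, χ (-((y : k) * b)) • piRep χ 1 b F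
      = ((Fintype.card k : ℂ) * F y) • Pi.single y (1 : ℂ) := by
    funext x
    have hterm : ∀ b : k, χ (-((y : k) * b)) * (χ ((x : k) * b) * F x)
        = χ (b * ((x : k) - y)) * F x := fun b => by
      rw [← mul_assoc, ← AddChar.map_add_eq_mul]
      ring_nf
    simp only [Finset.sum_apply, Pi.smul_apply, piRep_apply, smul_eq_mul, mul_one, hterm]
    rw [← Finset.sum_mul, AddChar.sum_mulShift _ hprim]
    by_cases hxy : x = y
    · simp [hxy]
    · simp [hxy, sub_eq_zero, Units.val_inj]
  have hy_mem : Pi.single y (1 : ℂ) ∈ W := by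
    have hmem : ∑ b : k, χ (-((y : k) * b)) • piRep χ 1 b F ∈ W :=
      W.sum_mem fun b _ => W.smul_mem _ (hW F hF 1 b)
    rw [hsum] at hmem
    exact (W.smul_mem_iff (mul_ne_zero (by simp) hy)).mp hmem
  have hsingle : ∀ x : kˣ, Pi.single x (1 : ℂ) ∈ W := fun x => by
    convert hW _ hy_mem (x⁻¹ * y) 0 using 1
    funext z
    simp [piRep_apply, Pi.single_apply, ← mul_assoc, mul_inv_eq_one]
  refine eq_top_iff.mpr fun G _ => ?_
  rw [pi_eq_sum_univ' G]
  refine W.sum_mem fun x _ => W.smul_mem _ ?_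
  convert hsingle x using 1

/-- A `π`-inductive algebra contains no non-zero nilpotent elements. -/
theorem inductive_algebra_no_nilpotents
    {k : Type*} [Field k] [Fintype k]
    (χ : AddChar k ℂ) (hχ : χ ≠ 1)
    (A : Subalgebra ℂ (Module.End ℂ (kˣ → ℂ)))
    (hA : IsInductive χ A) :
    ∀ T ∈ A, ∀ m : ℕ, T ^ m = 0 → T = 0 := by
  intro T hT m hm
  let N : Set (Module.End ℂ (kˣ → ℂ)) := {S | S ∈ A ∧ IsNilpotent S}
  let W : Submodule ℂ (kˣ → ℂ) := ⨅ S ∈ N, LinearMap.ker S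
  have mem_W : ∀ F, F ∈ W ↔ ∀ S ∈ N, S F = 0 := fun F => by
    simp [W, Submodule.mem_iInf]
  have hconj : ∀ S ∈ N, ∀ (a : kˣ) (b : k),
      (piRep χ a b).symm.toLinearMap * S * (piRep χ a b).toLinearMap ∈ N := by
    rintro S ⟨hS, n, hn⟩ a b
    constructor
    · have h := hA.2 S hS a⁻¹ (-((a⁻¹ : kˣ) * b))
      rwa [← piRep_symm, LinearEquiv.symm_symm] at h
    · refine ⟨n, ?_⟩
      have h := map_pow ((piRep χ a b).symm.conjAlgEquiv ℂ) S n
      rw [hn, map_zero] at h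
      exact h.symm
  have hW : ∀ F ∈ W, ∀ (a : kˣ) (b : k), piRep χ a b F ∈ W := fun F hF a b =>
    (mem_W _).mpr fun S hS =>
      (piRep χ a b).symm.map_eq_zero_iff.mp ((mem_W F).mp hF _ (hconj S hS a b))
  obtain ⟨F, hF0, hF⟩ := exists_ne_zero_forall_mem_apply_eq_zero N
    (fun S hS S' hS' => hA.1 S hS.1 S' hS'.1) (fun S hS => hS.2)
  have hne : W ≠ ⊥ := W.ne_bot_iff.mpr ⟨F, (mem_W F).mpr hF, hF0⟩
  have htop := eq_top_of_piRep_invariant hχ W hW hne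
  refine LinearMap.ext fun G => (mem_W G).mp (htop ▸ Submodule.mem_top) T ⟨hT, m, hm⟩

end AffineInductive
end

section
/- If A is a π-inductive algebra, then A_1 = 0; that is, the only T ∈ A satisfying π(1,b') ∘ T ∘ π(1,b')⁻¹ = χ(b')·T for all b' ∈ k is T = 0. -/
open scoped BigOperators

namespace AffineInductive

variable {k : Type*} [Field k]

/-- `B` has weight `y` under conjugation by the operators `π(1,b)`. -/
def HasWeight (χ : AddChar k ℂ) (B : Module.End ℂ (kˣ → ℂ)) (y : k) : Prop :=
  ∀ (b : k) (F : kˣ → ℂ), piRep χ 1 b (B F) = χ (y * b) • B (piRep χ 1 b F)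

lemma piRep_symm_zero_apply (χ : AddChar k ℂ) (a : kˣ) (F : kˣ → ℂ) (x : kˣ) :
    (piRep χ a 0).symm F x = F (x * a⁻¹) := by
  change χ (-(((x * a⁻¹ : kˣ) : k) * 0)) * F (x * a⁻¹) = _
  simp

lemma hasWeight_one (χ : AddChar k ℂ) : HasWeight χ 1 0 := by
  intro b F
  simp

lemma HasWeight.mul {χ : AddChar k ℂ} {B C : Module.End ℂ (kˣ → ℂ)} {y z : k}
    (hB : HasWeight χ B y) (hC : HasWeight χ C z) : HasWeight χ (B * C) (y + z) := by
  intro b F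
  rw [Module.End.mul_apply, hB, hC, map_smul, smul_smul, ← AddChar.map_add_eq_mul, ← add_mul,
    Module.End.mul_apply]

lemma HasWeight.of_conj {χ : AddChar k ℂ} {T : Module.End ℂ (kˣ → ℂ)} {y : k}
    (hT : ∀ b : k, (piRep χ 1 b).toLinearMap * T * (piRep χ 1 b).symm.toLinearMap
      = χ (y * b) • T) : HasWeight χ T y := by
  intro b F
  simpa using LinearMap.congr_fun (hT b) (piRep χ 1 b F)

/-- The conjugate of `T` by `π(a,0)`. -/
noncomputable def dilate (χ : AddChar k ℂ) (a : kˣ) (T : Module.End ℂ (kˣ → ℂ)) :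
    Module.End ℂ (kˣ → ℂ) :=
  (piRep χ a 0).toLinearMap * T * (piRep χ a 0).symm.toLinearMap

lemma dilate_apply (χ : AddChar k ℂ) (a : kˣ) (T : Module.End ℂ (kˣ → ℂ)) (F : kˣ → ℂ)
    (x : kˣ) : dilate χ a T F x = T (fun w => F (w * a⁻¹)) (x * a) := by
  have h : (piRep χ a 0).symm F = fun w => F (w * a⁻¹) :=
    funext fun w => piRep_symm_zero_apply χ a F w
  simp [dilate, piRep_apply, h]

lemma HasWeight.dilate {χ : AddChar k ℂ} {T : Module.End ℂ (kˣ → ℂ)} {y : k}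
    (hT : HasWeight χ T y) (a : kˣ) :
    HasWeight χ (dilate χ a T) (y * (a⁻¹ : kˣ)) := by
  intro b F
  funext x
  have h := congr_fun (hT ((a⁻¹ : kˣ) * b) (fun w => F (w * a⁻¹))) (x * a)
  have e : piRep χ 1 ((a⁻¹ : kˣ) * b) (fun w => F (w * a⁻¹))
      = fun w => piRep χ 1 b F (w * a⁻¹) := by
    funext w
    simp [piRep_apply, mul_assoc]
  rw [e] at h
  simp only [piRep_apply, mul_one, Pi.smul_apply, dilate_apply] at h ⊢
  rw [mul_assoc y, ← h]
  congr 2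
  simp [mul_assoc]

lemma eq_zero_of_forall_addChar_eq_one {χ : AddChar k ℂ} (hχ : χ ≠ 1) {t : k}
    (h : ∀ b, χ (t * b) = 1) : t = 0 := by
  by_contra ht
  refine hχ (DFunLike.ext _ _ fun b => ?_)
  simpa [mul_inv_cancel_left₀ ht] using h (t⁻¹ * b)

lemma HasWeight.apply_single_eq_zero [DecidableEq kˣ] {χ : AddChar k ℂ} (hχ : χ ≠ 1)
    {B : Module.End ℂ (kˣ → ℂ)} {y : k} (hB : HasWeight χ B y) {x z : kˣ}
    (hxz : (x : k) ≠ z + y) : B (Pi.single z 1) x = 0 := by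
  by_contra h0
  refine hxz (sub_eq_zero.1 (eq_zero_of_forall_addChar_eq_one hχ fun b => ?_))
  have e : piRep χ 1 b (Pi.single z 1) = χ (z * b) • Pi.single z (1 : ℂ) := by
    funext w
    rcases eq_or_ne w z with rfl | hw <;> simp [piRep_apply, *]
  have h := congr_fun (hB b (Pi.single z 1)) x
  rw [e, map_smul, smul_smul, ← AddChar.map_add_eq_mul, ← add_mul, piRep_apply, mul_one,
    Pi.smul_apply, smul_eq_mul] at h
  rw [sub_mul, AddChar.map_sub_eq_div, mul_right_cancel₀ h0 h, add_comm y]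
  exact div_self (χ.val_isUnit _).ne_zero

lemma apply_eq_sum_single [Fintype kˣ] [DecidableEq kˣ] (B : Module.End ℂ (kˣ → ℂ))
    (F : kˣ → ℂ) (x : kˣ) : B F x = ∑ z, F z * B (Pi.single z 1) x := by
  conv_lhs => rw [LinearMap.pi_apply_eq_sum_univ B F]
  simp only [Finset.sum_apply, Pi.smul_apply, smul_eq_mul]
  refine Finset.sum_congr rfl fun z _ => ?_
  congr 2
  refine congr_fun (congr_arg B (funext fun w => ?_)) x
  simp [Pi.single_apply, eq_comm]

lemma HasWeight.apply_self_eq_zero [Finite k] {χ : AddChar k ℂ} (hχ : χ ≠ 1)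
    {B : Module.End ℂ (kˣ → ℂ)} {x : kˣ} (hB : HasWeight χ B x) (F : kˣ → ℂ) :
    B F x = 0 := by
  classical
  have := Fintype.ofFinite kˣ
  rw [apply_eq_sum_single]
  refine Finset.sum_eq_zero fun z _ => ?_
  rw [hB.apply_single_eq_zero hχ (by simp), mul_zero]

lemma HasWeight.apply_eq [Finite k] [DecidableEq kˣ] {χ : AddChar k ℂ} (hχ : χ ≠ 1)
    {B : Module.End ℂ (kˣ → ℂ)} {y : k} (hB : HasWeight χ B y) {x z : kˣ}
    (hxz : (x : k) = z + y) (F : kˣ → ℂ) : B F x = F z * B (Pi.single z 1) x := by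
  have := Fintype.ofFinite kˣ
  rw [apply_eq_sum_single]
  refine Finset.sum_eq_single z (fun w _ hw => ?_) (by simp)
  rw [hB.apply_single_eq_zero hχ, mul_zero]
  rw [hxz]
  simpa [Units.ext_iff] using hw.symm

/-- In a finite field, `1` is a sum of elements of the form `s ^ i * (1 - s)` when `s ≠ 1`. -/
lemma one_mem_closure_pow_mul_one_sub [Finite k] {s : k} (hs : s ≠ 1) :
    (1 : k) ∈ AddSubmonoid.closure (Set.range fun i : ℕ => s ^ i * (1 - s)) := by
  have := Fintype.ofFinite k
  set M := AddSubmonoid.closure (Set.range fun i : ℕ => s ^ i * (1 - s))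
  have mul_mem : ∀ v ∈ M, s * v ∈ M := by
    intro v hv
    induction hv using AddSubmonoid.closure_induction with
    | mem v hv =>
      obtain ⟨i, rfl⟩ := hv
      exact AddSubmonoid.subset_closure ⟨i + 1, by ring⟩
    | zero => simp
    | add v w _ _ hv hw => rw [mul_add]; exact add_mem hv hw
  have neg_mem : ∀ v ∈ M, -v ∈ M := by
    intro v hv
    have e : (Fintype.card k - 1) • v = -v := by
      rw [nsmul_eq_mul, Nat.cast_sub Fintype.card_pos, FiniteField.cast_card_eq_zero]
      simp
    exact e ▸ nsmul_mem hv _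
  have pow_mem : ∀ n : ℕ, (1 - s) ^ (n + 1) ∈ M := by
    intro n
    induction n with
    | zero => exact AddSubmonoid.subset_closure ⟨0, by simp⟩
    | succ n ih =>
      have e : (1 - s) ^ (n + 1 + 1) = (1 - s) ^ (n + 1) + -(s * (1 - s) ^ (n + 1)) := by ring
      rw [e]
      exact add_mem ih (neg_mem _ (mul_mem _ ih))
  have h := pow_mem (Fintype.card k - 2)
  have hc := Fintype.one_lt_card (α := k)
  rwa [show Fintype.card k - 2 + 1 = Fintype.card k - 1 by omega,
    FiniteField.pow_card_sub_one_eq_one _ (sub_ne_zero.2 hs.symm)] at h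

/-- `A_1 = 0`: the only `T ∈ A` with
`π(1,b') ∘ T ∘ π(1,b')⁻¹ = χ(b')·T` for all `b'` is `T = 0`. -/
theorem weightSpace_one_eq_bot
    {k : Type*} [Field k] [Fintype k]
    (χ : AddChar k ℂ) (hχ : χ ≠ 1)
    (A : Subalgebra ℂ (Module.End ℂ (kˣ → ℂ)))
    (hA : IsInductive χ A) :
    ∀ T ∈ A,
      (∀ b' : k, (piRep χ 1 b').toLinearMap * T * (piRep χ 1 b').symm.toLinearMap
          = χ b' • T) →
        T = 0 := by
  intro T hTA hT
  classical
  have hTw : HasWeight χ T 1 := .of_conj (by simpa using hT)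
  by_contra hT0
  obtain ⟨z, x, hne⟩ : ∃ z x : kˣ, T (Pi.single z 1) x ≠ 0 := by
    by_contra! h
    refine hT0 (LinearMap.ext fun F => funext fun x => ?_)
    simp [apply_eq_sum_single T F x, h]
  have hxz : (x : k) = z + 1 := by
    by_contra h
    exact hne (hTw.apply_single_eq_zero hχ h)
  set c := T (Pi.single z 1) x
  set s : kˣ := z * x⁻¹ with hs
  have hsx : 1 - (s : k) = (x⁻¹ : kˣ) := by
    have h : (x : k) * (x⁻¹ : kˣ) = 1 := by simp
    rw [hs, Units.val_mul]
    linear_combination (-1 : k) * h + (x⁻¹ : kˣ) * hxz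
  have hs1 : (s : k) ≠ 1 := by
    intro h
    rw [h, sub_self] at hsx
    exact Units.ne_zero _ hsx.symm
  let _ : CommMonoid A :=
    { (inferInstance : Monoid A) with
      mul_comm := fun a b => Subtype.ext (hA.1 a a.2 b b.2) }
  let D : kˣ → A := fun g => ⟨dilate χ (x * g⁻¹) T, hA.2 T hTA _ _⟩
  have hDw (g : kˣ) : HasWeight χ (D g : Module.End ℂ (kˣ → ℂ)) (g * (1 - s)) := by
    convert hTw.dilate (x * g⁻¹) using 1
    rw [hsx]
    simp
  have hDapp (g : kˣ) (F : kˣ → ℂ) :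
      (D g : Module.End ℂ (kˣ → ℂ)) F g = c * F (s * g) := by
    change dilate χ (x * g⁻¹) T F g = _
    rw [dilate_apply, show g * (x * g⁻¹) = x by rw [mul_comm x]; simp,
      hTw.apply_eq hχ hxz, mul_comm]
    congr 2
    rw [hs, mul_inv_rev, inv_inv, mul_comm g, mul_assoc]
  have hpath (n : ℕ) : ∀ F : kˣ → ℂ,
      ((∏ i ∈ Finset.range n, D (s ^ i) : A) : Module.End ℂ (kˣ → ℂ)) F 1
        = c ^ n * F (s ^ n) := by
    induction n with
    | zero => intro F; simp
    | succ n ih =>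
      intro F
      rw [Finset.prod_range_succ]
      refine (ih ((D (s ^ n) : Module.End ℂ (kˣ → ℂ)) F)).trans ?_
      rw [hDapp, ← pow_succ', pow_succ c, mul_assoc]
  set Q : A := ∏ i ∈ Finset.range (orderOf s), D (s ^ i)
  have hdvd (i : ℕ) : D (s ^ i) ∣ Q := by
    rw [← pow_mod_orderOf]
    exact Finset.dvd_prod_of_mem (fun i => D (s ^ i))
      (Finset.mem_range.2 (Nat.mod_lt _ (orderOf_pos s)))
  have hQpow (n : ℕ) : ((Q ^ n : A) : Module.End ℂ (kˣ → ℂ)) 1 1 ≠ 0 := by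
    have h (F : kˣ → ℂ) : ((Q ^ n : A) : Module.End ℂ (kˣ → ℂ)) F 1
        = (c ^ orderOf s) ^ n * F 1 := by
      induction n generalizing F with
      | zero => simp
      | succ n ih =>
        rw [pow_succ]
        refine (ih ((Q : Module.End ℂ (kˣ → ℂ)) F)).trans ?_
        rw [hpath, pow_orderOf_eq_one, pow_succ, mul_assoc]
    rw [h]
    exact mul_ne_zero (pow_ne_zero n (pow_ne_zero _ hne)) one_ne_zero
  have hweight : ∀ y ∈ AddSubmonoid.closure (Set.range fun i : ℕ => (s : k) ^ i * (1 - s)),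
      ∃ (B : A) (n : ℕ), B ∣ Q ^ n ∧ HasWeight χ (B : Module.End ℂ (kˣ → ℂ)) y := by
    intro y hy
    induction hy using AddSubmonoid.closure_induction with
    | mem y hy =>
      obtain ⟨i, rfl⟩ := hy
      exact ⟨D (s ^ i), 1, by simpa using hdvd i, by simpa using hDw (s ^ i)⟩
    | zero => exact ⟨1, 0, one_dvd _, hasWeight_one χ⟩
    | add y w _ _ hy hw =>
      obtain ⟨B, n, hB, hBw⟩ := hy
      obtain ⟨C, m, hC, hCw⟩ := hw
      exact ⟨B * C, n + m, by rw [pow_add]; exact mul_dvd_mul hB hC, hBw.mul hCw⟩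
  obtain ⟨B, n, ⟨C, hC⟩, hBw⟩ := hweight 1 (one_mem_closure_pow_mul_one_sub hs1)
  refine hQpow n ?_
  rw [hC]
  exact HasWeight.apply_self_eq_zero (x := 1) hχ (by simpa using hBw)
    ((C : Module.End ℂ (kˣ → ℂ)) 1)

end AffineInductive
end

section
/- If A is a π-inductive algebra, then A_b = 0 for every b ∈ k with b ≠ 0. -/
open scoped BigOperators

namespace AffineInductive

variable {k : Type*} [Field k]

/-- A finite subset of a field avoiding `0` and `1` whose complement is stable under multiplication
by `1 - u⁻¹` for each of its elements `u` is empty. -/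
lemma eq_empty_of_mul_one_sub_inv_mem {k : Type*} [Field k] [Finite k] (S : Set k)
    (h0 : (0 : k) ∉ S) (h1 : (1 : k) ∉ S)
    (h : ∀ u ∈ S, ∀ v, v * (1 - u⁻¹) ∈ S → v ∈ S) : S = ∅ := by
  rw [Set.eq_empty_iff_forall_notMem]
  intro u hu
  have ne0 : ∀ {w}, w ∈ S → w ≠ 0 := fun hw e => h0 (e ▸ hw)
  have ne1 : ∀ {w}, w ∈ S → 1 - w⁻¹ ≠ 0 := fun {w} hw e => by
    have hw1 : w = 1 := inv_eq_one.mp (sub_eq_zero.mp e).symm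
    exact h1 (hw1 ▸ hw)
  have mul_mem : ∀ w ∈ S, ∀ v ∈ S, v * (1 - w⁻¹) ∈ S := by
    intro w hw v hv
    have hinj : Function.Injective (fun s : S =>
        (⟨s * (1 - w⁻¹)⁻¹, h w hw _ (by
          rw [inv_mul_cancel_right₀ (ne1 hw)]; exact s.2)⟩ : S)) := by
      intro s t hst
      exact Subtype.ext (mul_right_cancel₀ (inv_ne_zero (ne1 hw)) (congrArg Subtype.val hst))
    obtain ⟨s, hs⟩ := Finite.surjective_of_injective hinj ⟨v, hv⟩
    have hs' : (s : k) * (1 - w⁻¹)⁻¹ = v := congrArg Subtype.val hs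
    rw [← hs', inv_mul_cancel_right₀ (ne1 hw)]
    exact s.2
  -- the additive group of periods of `S`
  let M : Set k := {m | ∀ s, s + m ∈ S ↔ s ∈ S}
  have one_mem : (-1 : k) ∈ M := by
    have hsub : ∀ s ∈ S, s + -1 ∈ S := by
      intro s hs
      have hs' := mul_mem s hs s hs
      rwa [mul_sub, mul_one, mul_inv_cancel₀ (ne0 hs), sub_eq_add_neg] at hs'
    have hinj : Function.Injective (fun s : S => (⟨s + -1, hsub s s.2⟩ : S)) := by
      intro s t hst
      exact Subtype.ext (add_right_cancel (congrArg Subtype.val hst))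
    intro s
    refine ⟨fun hs => ?_, hsub s⟩
    obtain ⟨t, ht⟩ := Finite.surjective_of_injective hinj ⟨s + -1, hs⟩
    have hts : (t : k) = s := add_right_cancel (congrArg Subtype.val ht)
    exact hts ▸ t.2
  have smul_iff : ∀ v, v * (1 - u⁻¹) ∈ S ↔ v ∈ S := fun v => ⟨h u hu v, mul_mem u hu v⟩
  have period_mul : ∀ m ∈ M, m * (1 - u⁻¹) ∈ M := by
    intro m hm s
    have e : s = s * (1 - u⁻¹)⁻¹ * (1 - u⁻¹) := (inv_mul_cancel_right₀ (ne1 hu) s).symm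
    rw [e, ← add_mul, smul_iff, smul_iff, hm]
  have period_sub : ∀ m ∈ M, ∀ n ∈ M, m - n ∈ M := by
    intro m hm n hn s
    rw [← hn, add_assoc, sub_add_cancel, hm]
  let f : M → M := fun m => ⟨m * (1 - u⁻¹) - m, period_sub _ (period_mul m m.2) m m.2⟩
  have f_val : ∀ m : M, ((f m : M) : k) = m * -u⁻¹ := fun m => by
    change (m : k) * (1 - u⁻¹) - m = _
    ring
  have hinj : Function.Injective f := by
    intro m n hmn
    have hmn' := congrArg Subtype.val hmn
    rw [f_val, f_val] at hmn'
    exact Subtype.ext (mul_right_cancel₀ (neg_ne_zero.mpr (inv_ne_zero (ne0 hu))) hmn')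
  obtain ⟨m, hm⟩ := Finite.surjective_of_injective hinj ⟨-1, one_mem⟩
  have hm' := congrArg Subtype.val hm
  rw [f_val] at hm'
  have hmu : (m : k) = u := by
    have := ne0 hu
    field_simp at hm'
    linear_combination -hm'
  have := m.2 0
  rw [zero_add, hmu] at this
  exact h0 (this.mp hu)

/-- Extension by zero of a function on `kˣ` to `k`. -/
noncomputable def extendZero (F : kˣ → ℂ) : k → ℂ := Function.extend Units.val F 0

@[simp]
lemma extendZero_coe (F : kˣ → ℂ) (x : kˣ) : extendZero F x = F x :=
  Units.val_injective.extend_apply F 0 x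

@[simp]
lemma extendZero_zero (F : kˣ → ℂ) : extendZero F (0 : k) = 0 :=
  Function.extend_apply' _ _ _ fun ⟨x, hx⟩ => x.ne_zero hx

lemma extendZero_one {t : k} (ht : t ≠ 0) : extendZero (1 : kˣ → ℂ) t = 1 := by
  lift t to kˣ using ht.isUnit
  simp

lemma apply_single_eq_zero [DecidableEq kˣ] {χ : AddChar k ℂ} (hχ : χ ≠ 1)
    {A : Subalgebra ℂ (Module.End ℂ (kˣ → ℂ))} {b : k} {T : Module.End ℂ (kˣ → ℂ)}
    (hT : T ∈ weightSpace χ A b) {x y : kˣ} (hxy : (x : k) - b ≠ y) :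
    T (Pi.single y 1) x = 0 := by
  by_contra hne
  obtain ⟨t, ht⟩ := AddChar.ne_one_iff.mp hχ
  have hd : (x : k) - b - y ≠ 0 := sub_ne_zero.mpr hxy
  set b' := t / ((x : k) - b - y) with hb'
  have key := congrFun (LinearMap.congr_fun (hT.2 b') (Pi.single y 1)) x
  have hs : (piRep χ 1 b').symm (Pi.single y 1) = χ (-(y * b')) • Pi.single y 1 := by
    funext z
    change χ (-(((z * 1⁻¹ : kˣ) : k) * b')) * (Pi.single y (1 : ℂ) : kˣ → ℂ) (z * 1⁻¹) = _
    by_cases hz : z = y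
    · subst hz; simp
    · simp [hz]
  have key' : χ (x * b') * T ((piRep χ 1 b').symm (Pi.single y 1)) (x * 1) =
      χ (b * b') * T (Pi.single y 1) x := key
  rw [hs, map_smul, mul_one, Pi.smul_apply, smul_eq_mul, ← mul_assoc,
    ← AddChar.map_add_eq_mul] at key'
  have hchar := mul_right_cancel₀ hne key'
  apply ht
  have ht' : t = x * b' + -(y * b') + -(b * b') := by
    rw [hb']
    field_simp
    ring
  rw [ht', AddChar.map_add_eq_mul, hchar, ← AddChar.map_add_eq_mul, add_neg_cancel,
    AddChar.map_zero_eq_one]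

/-- An operator of weight `b` is a weighted translation by `b`. -/
lemma apply_eq_of_mem_weightSpace [Fintype k] {χ : AddChar k ℂ} (hχ : χ ≠ 1)
    {A : Subalgebra ℂ (Module.End ℂ (kˣ → ℂ))} {b : k} {T : Module.End ℂ (kˣ → ℂ)}
    (hT : T ∈ weightSpace χ A b) (F : kˣ → ℂ) (x : kˣ) :
    T F x = T 1 x * extendZero F (x - b) := by
  classical
  have hsum : ∀ G : kˣ → ℂ, T G x = ∑ y, G y * T (Pi.single y 1) x := by
    intro G
    have := congrFun (LinearMap.pi_apply_eq_sum_univ T G) x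
    rw [this, Finset.sum_apply]
    refine Finset.sum_congr rfl fun y _ => ?_
    rw [Pi.smul_apply, smul_eq_mul]
    refine congrArg (fun G => _ * T G x) ?_
    funext z
    simp [Pi.single_apply, eq_comm]
  by_cases hxb : (x : k) - b = 0
  · rw [hxb, extendZero_zero, mul_zero, hsum]
    refine Finset.sum_eq_zero fun y _ => ?_
    rw [apply_single_eq_zero hχ hT (hxb ▸ y.ne_zero.symm), mul_zero]
  · obtain ⟨y, hy⟩ := IsUnit.mk0 _ hxb
    have hy' : ∀ G : kˣ → ℂ, T G x = G y * T (Pi.single y 1) x := by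
      intro G
      rw [hsum]
      refine Finset.sum_eq_single y (fun z _ hz => ?_) (by simp)
      rw [apply_single_eq_zero hχ hT, mul_zero]
      rw [← hy]
      exact fun e => hz (Units.ext e.symm)
    rw [← hy, extendZero_coe, hy' F, hy' 1, Pi.one_apply, one_mul, mul_comm]

/-- The conjugate by `π(a,0)` of an operator of weight `b` is a weighted translation by `b / a`. -/
lemma extendZero_conj_apply [Fintype k] {χ : AddChar k ℂ} (hχ : χ ≠ 1)
    {A : Subalgebra ℂ (Module.End ℂ (kˣ → ℂ))} {b : k} {T : Module.End ℂ (kˣ → ℂ)}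
    (hT : T ∈ weightSpace χ A b) (a : kˣ) (F : kˣ → ℂ) (t : k) :
    extendZero (((piRep χ a 0).toLinearMap * T * (piRep χ a 0).symm.toLinearMap) F) t =
      extendZero (T 1) (t * a) * extendZero F (t - b * (a : k)⁻¹) := by
  by_cases ht : t = 0
  · simp [ht]
  lift t to kˣ using IsUnit.mk0 t ht
  rw [extendZero_coe, ← Units.val_mul, extendZero_coe]
  change χ (t * 0) * T ((piRep χ a 0).symm F) (t * a) = _
  rw [mul_zero, AddChar.map_zero_eq_one, one_mul, apply_eq_of_mem_weightSpace hχ hT]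
  congr 1
  have e : (t : k) - b * (a : k)⁻¹ = (((t * a : kˣ) : k) - b) * (a : k)⁻¹ := by
    have := a.ne_zero
    rw [Units.val_mul]
    field_simp
  rw [e]
  by_cases hs : ((t * a : kˣ) : k) - b = 0
  · rw [hs, zero_mul, extendZero_zero, extendZero_zero]
  obtain ⟨s, hs'⟩ := IsUnit.mk0 _ hs
  rw [← hs', ← Units.val_inv_eq_inv_val, ← Units.val_mul, extendZero_coe, extendZero_coe]
  change χ (-(((s * a⁻¹ : kˣ) : k) * 0)) * F (s * a⁻¹) = _
  simp

/-- `A_b = 0` for every `b ≠ 0`. -/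
theorem weightSpace_ne_zero_eq_bot
    {k : Type*} [Field k] [Fintype k]
    (χ : AddChar k ℂ) (hχ : χ ≠ 1)
    (A : Subalgebra ℂ (Module.End ℂ (kˣ → ℂ)))
    (hA : IsInductive χ A) :
    ∀ b : k, b ≠ 0 → weightSpace χ A b = ⊥ := by
  intro b hb
  rw [eq_bot_iff]
  intro T hT
  rw [Submodule.mem_bot]
  set φ := extendZero (T 1) with hφ
  have hφb : φ b = 0 := by
    obtain ⟨x, rfl⟩ := IsUnit.mk0 b hb
    rw [hφ, extendZero_coe, apply_eq_of_mem_weightSpace hχ hT, sub_self, extendZero_zero, mul_zero]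
  have hcomm : ∀ u v : kˣ,
      φ (b * u) * (φ ((b - b * (u : k)⁻¹) * v) *
        extendZero 1 (b - b * (u : k)⁻¹ - b * (v : k)⁻¹)) =
      φ (b * v) * (φ ((b - b * (v : k)⁻¹) * u) *
        extendZero 1 (b - b * (v : k)⁻¹ - b * (u : k)⁻¹)) := by
    obtain ⟨C, hCA, hC⟩ : ∃ C : kˣ → Module.End ℂ (kˣ → ℂ), (∀ a, C a ∈ A) ∧ ∀ a F t,
        extendZero (C a F) t = φ (t * a) * extendZero F (t - b * (a : k)⁻¹) :=
      ⟨_, fun a => hA.2 T hT.1 a 0, extendZero_conj_apply hχ hT⟩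
    intro u v
    have h := congrArg (fun G => extendZero G b)
      (LinearMap.congr_fun (hA.1 _ (hCA u) _ (hCA v)) 1)
    simpa only [Module.End.mul_apply, hC] using h
  have hempty : {t : k | φ (b * t) ≠ 0} = ∅ := by
    apply eq_empty_of_mul_one_sub_inv_mem
    · simp [hφ]
    · simp [hφb]
    · intro u hu v hv hv0
      have hu0 : u ≠ 0 := by
        rintro rfl
        simp [hφ] at hu
      have hvne : v ≠ 0 := by
        rintro rfl
        simp [hφ] at hv
      have h := hcomm (Units.mk0 u hu0) (Units.mk0 v hvne)
      rw [Units.val_mk0, Units.val_mk0, hv0, zero_mul] at h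
      have e : (b - b * u⁻¹) * v = b * (v * (1 - u⁻¹)) := by ring
      have hne : b - b * u⁻¹ - b * v⁻¹ ≠ 0 := by
        intro h0
        apply hv
        rw [← e, sub_eq_zero.mp h0, inv_mul_cancel_right₀ hvne, hφb]
      rw [extendZero_one hne, mul_one, e] at h
      exact mul_ne_zero hu hv h
  refine LinearMap.ext fun F => funext fun x => ?_
  have hx : T 1 x = 0 := by
    by_contra hne
    have : b⁻¹ * (x : k) ∈ {t : k | φ (b * t) ≠ 0} := by
      rw [Set.mem_ofPred_eq, mul_inv_cancel_left₀ hb, hφ, extendZero_coe]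
      exact hne
    rw [hempty] at this
    exact this
  rw [apply_eq_of_mem_weightSpace hχ hT, hx, zero_mul]
  rfl

end AffineInductive
end

section
/- The representation π is irreducible: if W is a complex linear subspace of H that is invariant under π(a,b) for every a ∈ k^× and b ∈ k, then W = 0 or W = H. -/
open scoped BigOperators

namespace AffineInductive

variable {k : Type*} [Field k]

/-- Fourier averaging of the operators `π(d⁻¹c, b)` over `b` isolates the value `F c` at the
point `d`. -/
theorem sum_smul_piRep {k : Type*} [Field k] [Fintype k] [DecidableEq k] {χ : AddChar k ℂ}
    (hχ : χ ≠ 1) (F : kˣ → ℂ) (c d : kˣ) :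
    ∑ b : k, χ (-((d : k) * b)) • piRep χ (d⁻¹ * c) b F =
      (Fintype.card k * F c) • (Pi.single d 1 : kˣ → ℂ) := by
  funext x
  have hsum : ∑ b : k, χ (b * ((x : k) - d)) = if (x : k) - d = 0 then Fintype.card k else 0 :=
    AddChar.sum_mulShift _ (AddChar.IsPrimitive.of_ne_one hχ)
  have hterm (b : k) : χ (-((d : k) * b)) * (χ ((x : k) * b) * F (x * (d⁻¹ * c))) =
      χ (b * ((x : k) - d)) * F (x * (d⁻¹ * c)) := by
    rw [← mul_assoc, ← AddChar.map_add_eq_mul]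
    ring_nf
  have hpi (b : k) : piRep χ (d⁻¹ * c) b F x = χ ((x : k) * b) * F (x * (d⁻¹ * c)) := rfl
  simp only [Finset.sum_apply, Pi.smul_apply, smul_eq_mul, hpi, hterm]
  rw [← Finset.sum_mul, hsum]
  by_cases h : x = d
  · subst h
    simp
  · simp [h, sub_eq_zero, Units.val_inj]

/-- The representation `π` is irreducible. -/
theorem piRep_irreducible
    {k : Type*} [Field k] [Fintype k]
    (χ : AddChar k ℂ) (hχ : χ ≠ 1) :
    ∀ W : Submodule ℂ (kˣ → ℂ),
      (∀ (a : kˣ) (b : k), ∀ F ∈ W, piRep χ a b F ∈ W) → W = ⊥ ∨ W = ⊤ := by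
  classical
  intro W hW
  refine or_iff_not_imp_left.mpr fun hne => ?_
  obtain ⟨F, hF, hF0⟩ := W.ne_bot_iff.mp hne
  obtain ⟨c, hc⟩ := Function.ne_iff.mp hF0
  have hsingle (d : kˣ) : (Pi.single d 1 : kˣ → ℂ) ∈ W := by
    have hmem := W.sum_mem fun b (_ : b ∈ Finset.univ) =>
      W.smul_mem (χ (-((d : k) * b))) (hW (d⁻¹ * c) b F hF)
    rw [sum_smul_piRep hχ] at hmem
    exact (W.smul_mem_iff (mul_ne_zero (Nat.cast_ne_zero.mpr Fintype.card_ne_zero) hc)).mp hmem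
  refine eq_top_iff.mpr fun G _ => ?_
  rw [pi_eq_sum_univ' G]
  exact W.sum_mem fun d _ => W.smul_mem _ (hsingle d)

end AffineInductive
end
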